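/- Fix δ ∈ (0,1), set a = |(1−δ)(1 − log(1−δ)) − 1| and σ = 2M, and define ε_t^+ = √(2π) β_t σ [ e^{β_t²σ²/(2(1−δ)n_t)} / √((1−δ)n_t) + e^{β_t²σ² − a n_t} ] and ε_t^− = −ε_t^+. Then for all t ≥ 0 and all x, y ∈ E with x ≠ y, ε_t^− q_{β_t}(x,y) ≤ q̃_t(x,y) − q_{β_t}(x,y) ≤ ε_t^+ q_{β_t}(x,y). -/

import Mathlib

open MeasureTheory
open scoped BigOperators ENNReal Real

/-- The noise-free Metropolis transition probability (off-diagonal):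
`q_β(x,y) = q0(x,y) e^{-β max(J y - J x, 0)}`. -/
noncomputable def qMetropolis {E : Type*} (q0 : E → E → ℝ) (J : E → ℝ) (β : ℝ)
    (x y : E) : ℝ :=
  q0 x y * Real.exp (-β * max (J y - J x) 0)

/-- The noisy transition probability (off-diagonal):
`q̃(x,y) = q0(x,y) E[exp (-(β/N) max (0, Σ_{i=1}^N (U(y,ω̃_i) - U(x,ω_i))))]`, where
`N = 1 + P` with `P` Poisson of mean `n` and, given `N`, the `ω_i` are i.i.d. `P_x` and the
`ω̃_i` are i.i.d. `P_y`, all independent. -/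
noncomputable def qNoisy {E Ω : Type*} [MeasurableSpace Ω]
    (q0 : E → E → ℝ) (P : E → Measure Ω) (U : E → Ω → ℝ) (β n : ℝ) (x y : E) : ℝ :=
  q0 x y * ∑' k : ℕ, (Real.exp (-n) * n ^ k / (Nat.factorial k)) *
    ∫ ω : (Fin (k + 1) → Ω) × (Fin (k + 1) → Ω),
      Real.exp (-(β / (k + 1)) * max 0 (∑ i, (U y (ω.2 i) - U x (ω.1 i))))
      ∂((Measure.pi fun _ : Fin (k + 1) => P x).prod (Measure.pi fun _ : Fin (k + 1) => P y))

open ProbabilityTheory in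
/-- If `D` is sub-Gaussian with variance proxy `s ^ 2`, then `E[e^{t|D|}] ≤ 2 e^{s² t² / 2}`. -/
lemma ProbabilityTheory.HasSubgaussianMGF.integral_exp_mul_abs_le {Ω : Type*} [MeasurableSpace Ω]
    {μ : Measure Ω} {D : Ω → ℝ} {c : NNReal} (hD : HasSubgaussianMGF D c μ) (t : ℝ) :
    Integrable (fun ω => Real.exp (t * |D ω|)) μ ∧
      ∫ ω, Real.exp (t * |D ω|) ∂μ ≤ 2 * Real.exp (c * t ^ 2 / 2) := by
  have h1 := hD.integrable_exp_mul t
  have h2 := hD.integrable_exp_mul (-t)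
  have hint : Integrable (fun ω => Real.exp (t * |D ω|)) μ :=
    integrable_exp_mul_abs h1 h2
  refine ⟨hint, ?_⟩
  calc ∫ ω, Real.exp (t * |D ω|) ∂μ
      ≤ ∫ ω, (Real.exp (t * D ω) + Real.exp (-t * D ω)) ∂μ := by
        refine integral_mono hint (h1.add h2) fun ω => ?_
        have e1 := Real.exp_pos (t * D ω)
        have e2 := Real.exp_pos (-t * D ω)
        rcases abs_cases (D ω) with ⟨h, -⟩ | ⟨h, -⟩
        · simp only [h]; linarith
        · simp only [h, mul_neg, ← neg_mul]; linarith
    _ = mgf D μ t + mgf D μ (-t) := integral_add h1 h2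
    _ ≤ Real.exp (c * t ^ 2 / 2) + Real.exp (c * (-t) ^ 2 / 2) :=
        add_le_add (hD.mgf_le t) (hD.mgf_le (-t))
    _ = 2 * Real.exp (c * t ^ 2 / 2) := by rw [neg_sq]; ring

lemma abs_exp_sub_one_le_mul_exp_abs (u : ℝ) : |Real.exp u - 1| ≤ |u| * Real.exp |u| := by
  rcases le_total 0 u with h | h
  · rw [abs_of_nonneg h, abs_of_nonneg (by linarith [Real.add_one_le_exp u])]
    have h1 := Real.add_one_le_exp (-u)
    have h2 : Real.exp (-u) * Real.exp u = 1 := by rw [← Real.exp_add]; simp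
    nlinarith [Real.exp_pos u]
  · rw [abs_of_nonpos h, abs_of_nonpos (by linarith [Real.exp_le_one_iff.2 h])]
    nlinarith [Real.add_one_le_exp u, Real.one_le_exp (neg_nonneg.2 h)]

/-- Perturbing the argument of `z ↦ e^{-β max(z, 0)}` by `d`, with an auxiliary scale `s`. -/
lemma abs_exp_neg_mul_max_sub_le {β s : ℝ} (hβ : 0 ≤ β) (hs : 0 < s) (m d : ℝ) :
    |Real.exp (-β * max (m + d) 0) - Real.exp (-β * max m 0)| ≤
      Real.exp (-β * max m 0) * (β * s * Real.exp (-1) * Real.exp ((s⁻¹ + β) * |d|)) := by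
  set z := max (m + d) 0 - max m 0 with hz
  have hzd : |z| ≤ |d| := by
    have := abs_max_sub_max_le_abs (m + d) m 0
    simpa [hz] using this
  have h1 : Real.exp (-β * max (m + d) 0) - Real.exp (-β * max m 0) =
      Real.exp (-β * max m 0) * (Real.exp (-β * z) - 1) := by
    rw [mul_sub, ← Real.exp_add, hz]; ring_nf
  rw [h1, abs_mul, Real.abs_exp]
  refine mul_le_mul_of_nonneg_left ?_ (Real.exp_pos _).le
  have hu : |-β * z| ≤ β * |d| := by
    rw [abs_mul, abs_neg, abs_of_nonneg hβ]; gcongr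
  have hd : |d| ≤ s * Real.exp (s⁻¹ * |d| - 1) := by
    have := Real.add_one_le_exp (s⁻¹ * |d| - 1)
    calc |d| = s * (s⁻¹ * |d|) := by field_simp
      _ ≤ _ := by gcongr; linarith
  calc |Real.exp (-β * z) - 1| ≤ |-β * z| * Real.exp |-β * z| := abs_exp_sub_one_le_mul_exp_abs _
    _ ≤ (β * |d|) * Real.exp (β * |d|) := by gcongr
    _ ≤ (β * (s * Real.exp (s⁻¹ * |d| - 1))) * Real.exp (β * |d|) := by gcongr
    _ = β * s * (Real.exp (s⁻¹ * |d| - 1) * Real.exp (β * |d|)) := by ring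
    _ = β * s * (Real.exp (-1) * Real.exp ((s⁻¹ + β) * |d|)) := by
        rw [← Real.exp_add, ← Real.exp_add]; ring_nf
    _ = _ := by ring

open ProbabilityTheory in
/-- A sub-Gaussian perturbation of variance proxy `s²` changes `e^{-β max(m, 0)}` in mean by a
relative amount of at most `2 β s e^{β² s²}`. -/
lemma ProbabilityTheory.HasSubgaussianMGF.abs_integral_exp_neg_mul_max_sub_le
    {Ω : Type*} [MeasurableSpace Ω] {μ : Measure Ω} [IsProbabilityMeasure μ] {D : Ω → ℝ}
    {c : NNReal} (hD : HasSubgaussianMGF D c μ)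
    {β s : ℝ} (hβ : 0 ≤ β) (hs : 0 < s) (hcs : (c : ℝ) = s ^ 2) (m : ℝ) :
    |∫ ω, Real.exp (-β * max (m + D ω) 0) ∂μ - Real.exp (-β * max m 0)| ≤
      Real.exp (-β * max m 0) * (2 * β * s * Real.exp (β ^ 2 * s ^ 2)) := by
  have hDm : AEMeasurable D μ := hD.aemeasurable
  have hint : Integrable (fun ω => Real.exp (-β * max (m + D ω) 0)) μ := by
    refine Integrable.of_bound (C := 1) ?_ (ae_of_all _ fun ω => ?_)
    · exact (((hDm.const_add m).max aemeasurable_const).const_mul _).exp.aestronglyMeasurable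
    · rw [Real.norm_eq_abs, Real.abs_exp, Real.exp_le_one_iff]
      have := mul_nonneg hβ (le_max_right (m + D ω) 0)
      linarith
  obtain ⟨hi, hle⟩ := hD.integral_exp_mul_abs_le (s⁻¹ + β)
  have hexp : Real.exp (-1) * Real.exp (c * (s⁻¹ + β) ^ 2 / 2) ≤ Real.exp (β ^ 2 * s ^ 2) := by
    rw [← Real.exp_add, Real.exp_le_exp, hcs, ← mul_pow, mul_add, mul_inv_cancel₀ hs.ne']
    nlinarith [sq_nonneg (1 - s * β)]
  calc |∫ ω, Real.exp (-β * max (m + D ω) 0) ∂μ - Real.exp (-β * max m 0)|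
      = |∫ ω, (Real.exp (-β * max (m + D ω) 0) - Real.exp (-β * max m 0)) ∂μ| := by
        rw [integral_sub hint (integrable_const _)]; simp
    _ ≤ ∫ ω, |Real.exp (-β * max (m + D ω) 0) - Real.exp (-β * max m 0)| ∂μ :=
        abs_integral_le_integral_abs
    _ ≤ ∫ ω, Real.exp (-β * max m 0) *
          (β * s * Real.exp (-1) * Real.exp ((s⁻¹ + β) * |D ω|)) ∂μ :=
        integral_mono (hint.sub (integrable_const _)).abs ((hi.const_mul _).const_mul _)
          fun ω => abs_exp_neg_mul_max_sub_le hβ hs m (D ω)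
    _ = Real.exp (-β * max m 0) *
          (β * s * Real.exp (-1) * ∫ ω, Real.exp ((s⁻¹ + β) * |D ω|) ∂μ) := by
        rw [integral_const_mul, integral_const_mul]
    _ ≤ Real.exp (-β * max m 0) *
          (β * s * Real.exp (-1) * (2 * Real.exp (c * (s⁻¹ + β) ^ 2 / 2))) := by gcongr
    _ = Real.exp (-β * max m 0) *
          (2 * β * s * (Real.exp (-1) * Real.exp (c * (s⁻¹ + β) ^ 2 / 2))) := by ring
    _ ≤ _ := by gcongr

open ProbabilityTheory in
lemma ProbabilityTheory.HasSubgaussianMGF.sum_pi {ι Ω : Type*} [Fintype ι] [MeasurableSpace Ω]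
    {μ : Measure Ω} [SigmaFinite μ] {f : Ω → ℝ} {c : NNReal} (hf : HasSubgaussianMGF f c μ) :
    HasSubgaussianMGF (fun ω : ι → Ω => ∑ i, f (ω i)) (Fintype.card ι * c)
      (Measure.pi fun _ => μ) := by
  refine ⟨fun t => ?_, fun t => ?_⟩
  · simp only [Finset.mul_sum, Real.exp_sum]
    exact Integrable.fintype_prod (f := fun _ ω => Real.exp (t * f ω))
      fun _ => hf.integrable_exp_mul t
  · simp only [mgf, Finset.mul_sum, Real.exp_sum]
    rw [integral_fintype_prod_eq_pow (fun ω => Real.exp (t * f ω))]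
    calc (∫ ω, Real.exp (t * f ω) ∂μ) ^ Fintype.card ι
        ≤ Real.exp (c * t ^ 2 / 2) ^ Fintype.card ι :=
          pow_le_pow_left₀ (integral_nonneg fun _ => (Real.exp_pos _).le) (hf.mgf_le t) _
      _ = _ := by rw [← Real.exp_nat_mul]; congr 1; push_cast; ring

open ProbabilityTheory in
lemma ProbabilityTheory.HasSubgaussianMGF.snd_sub_fst {Ω Ω' : Type*} [MeasurableSpace Ω]
    [MeasurableSpace Ω'] {μ : Measure Ω} {ν : Measure Ω'} [SFinite μ] [SFinite ν]
    {f : Ω → ℝ} {g : Ω' → ℝ} {c d : NNReal}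
    (hf : HasSubgaussianMGF f c μ) (hg : HasSubgaussianMGF g d ν) :
    HasSubgaussianMGF (fun z : Ω × Ω' => g z.2 - f z.1) (c + d) (μ.prod ν) := by
  have key (t : ℝ) (z : Ω × Ω') : Real.exp (t * (g z.2 - f z.1)) =
      Real.exp (-t * f z.1) * Real.exp (t * g z.2) := by
    rw [← Real.exp_add]; ring_nf
  refine ⟨fun t => ?_, fun t => ?_⟩
  · simp only [key]
    exact (hf.integrable_exp_mul (-t)).mul_prod (hg.integrable_exp_mul t)
  · simp only [mgf, key]
    rw [integral_prod_mul (fun ω => Real.exp (-t * f ω)) (fun ω => Real.exp (t * g ω))]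
    calc _ ≤ Real.exp (c * (-t) ^ 2 / 2) * Real.exp (d * t ^ 2 / 2) :=
          mul_le_mul (hf.mgf_le (-t)) (hg.mgf_le t)
            (integral_nonneg fun _ => (Real.exp_pos _).le) (Real.exp_pos _).le
      _ = _ := by rw [← Real.exp_add]; congr 1; push_cast; ring

open ProbabilityTheory in
/-- Bound on the acceptance probability for a fixed number `k + 1` of samples. -/
lemma abs_integral_noisy_acceptance_sub_le {Ω : Type*} [MeasurableSpace Ω]
    (μ ν : Measure Ω) [IsProbabilityMeasure μ] [IsProbabilityMeasure ν] {f g : Ω → ℝ}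
    (hf : Measurable f) (hg : Measurable g) {M : ℝ} (hM : 0 < M)
    (hfM : ∀ ω, f ω ∈ Set.Icc 0 M) (hgM : ∀ ω, g ω ∈ Set.Icc 0 M) {β : ℝ} (hβ : 0 ≤ β) (k : ℕ) :
    |∫ ω : (Fin (k + 1) → Ω) × (Fin (k + 1) → Ω),
        Real.exp (-(β / (k + 1)) * max 0 (∑ i, (g (ω.2 i) - f (ω.1 i))))
        ∂((Measure.pi fun _ : Fin (k + 1) => μ).prod (Measure.pi fun _ : Fin (k + 1) => ν)) -
      Real.exp (-β * max (∫ ω, g ω ∂ν - ∫ ω, f ω ∂μ) 0)| ≤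
    Real.exp (-β * max (∫ ω, g ω ∂ν - ∫ ω, f ω ∂μ) 0) *
      (β * (2 * M) / √(k + 1) * Real.exp (β ^ 2 * (2 * M) ^ 2 / (2 * (k + 1)))) := by
  have hfs := hasSubgaussianMGF_of_mem_Icc (μ := μ) hf.aemeasurable (ae_of_all _ hfM)
  have hgs := hasSubgaussianMGF_of_mem_Icc (μ := ν) hg.aemeasurable (ae_of_all _ hgM)
  have hS := (hfs.sum_pi (ι := Fin (k + 1))).snd_sub_fst (hgs.sum_pi (ι := Fin (k + 1)))
  have hk : (0 : ℝ) < k + 1 := by positivity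
  have hD := hS.const_mul ((k + 1 : ℝ)⁻¹)
  set m := ∫ ω, g ω ∂ν - ∫ ω, f ω ∂μ with hm
  have hs : 0 < M / √(2 * (k + 1)) := by positivity
  have hss : (M / √(2 * (k + 1))) ^ 2 = M ^ 2 / (2 * (k + 1)) := by
    rw [div_pow, Real.sq_sqrt (by positivity)]
  have := hD.abs_integral_exp_neg_mul_max_sub_le hβ hs (by
    rw [hss]
    refine (NNReal.coe_mul _ _).trans ?_
    change (k + 1 : ℝ)⁻¹ ^ 2 * _ = _
    simp only [Fintype.card_fin, sub_zero]
    push_cast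
    simp only [Real.norm_eq_abs, abs_of_pos hM]
    field_simp
    ring) m
  refine le_trans (le_of_eq ?_) (this.trans ?_)
  · congr 3
    refine funext fun ω => ?_
    congr 1
    have : m + (k + 1 : ℝ)⁻¹ * (∑ i, (g (ω.2 i) - ∫ ω, g ω ∂ν) - ∑ i, (f (ω.1 i) - ∫ ω, f ω ∂μ))
        = (k + 1 : ℝ)⁻¹ * ∑ i, (g (ω.2 i) - f (ω.1 i)) := by
      simp only [Finset.sum_sub_distrib, Finset.sum_const, Finset.card_univ, Fintype.card_fin,
        nsmul_eq_mul, hm]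
      push_cast
      field_simp
      ring
    rw [this, max_comm, ← mul_zero (k + 1 : ℝ)⁻¹, ← mul_max_of_nonneg _ _ (by positivity)]
    simp only [mul_zero]
    ring
  · rw [hss]
    gcongr ?_ * (?_ * Real.exp ?_)
    · rw [← mul_div_assoc, mul_comm 2 β, mul_assoc]
      gcongr
      linarith
    · rw [← mul_div_assoc]
      gcongr
      linarith

lemma hasSum_poisson_weight_mul_pow (n r : ℝ) :
    HasSum (fun k : ℕ => Real.exp (-n) * n ^ k / (Nat.factorial k) * r ^ k)
      (Real.exp (n * r - n)) := by
  have h := (NormedSpace.expSeries_div_hasSum_exp (n * r)).mul_left (Real.exp (-n))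
  rw [← Real.exp_eq_exp_ℝ, ← Real.exp_add, neg_add_eq_sub] at h
  have heq (k : ℕ) : Real.exp (-n) * ((n * r) ^ k / (Nat.factorial k)) =
      Real.exp (-n) * n ^ k / (Nat.factorial k) * r ^ k := by
    rw [mul_pow]; ring
  simpa only [heq] using h

/-- Split according to whether the sample size `k + 1` is at least `ρ n`, bounding the indicator
of the complementary event by the Chernoff weight `ρ ^ k / ρ ^ (ρ n)`. -/
lemma div_sqrt_mul_exp_le_chernoff {b n ρ : ℝ} (hb : 0 ≤ b) (hn : 0 < n) (hρ : 0 < ρ) (hρ1 : ρ < 1)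
    (k : ℕ) :
    b / √(k + 1) * Real.exp (b ^ 2 / (2 * (k + 1))) ≤
      b * (Real.exp (b ^ 2 / (2 * ρ * n)) / √(ρ * n)) +
        b * Real.exp (b ^ 2 - ρ * n * Real.log ρ) * ρ ^ k := by
  have hk : (0 : ℝ) ≤ k := by positivity
  rcases le_total (ρ * n) (k + 1) with h | h
  · refine le_add_of_le_of_nonneg ?_ (by positivity)
    rw [div_mul_eq_mul_div, mul_div_assoc, mul_assoc 2]
    gcongr
  · refine le_add_of_nonneg_of_le (by positivity) ?_
    have h1 : b / √(k + 1) ≤ b := div_le_self hb (Real.one_le_sqrt.2 (by linarith))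
    have h2 : b ^ 2 / (2 * (k + 1)) ≤ b ^ 2 := div_le_self (sq_nonneg b) (by linarith)
    have h3 : Real.exp (b ^ 2) ≤ Real.exp (b ^ 2 - ρ * n * Real.log ρ) * ρ ^ k := by
      rw [← Real.exp_log hρ, ← Real.exp_nat_mul, Real.log_exp, ← Real.exp_add, Real.exp_le_exp,
        Real.exp_log hρ]
      nlinarith [Real.log_neg hρ hρ1]
    rw [mul_assoc]
    gcongr
    exact (Real.exp_le_exp.2 h2).trans h3

lemma abs_chernoff_exponent {ρ : ℝ} (hρ : 0 < ρ) :
    |ρ * (1 - Real.log ρ) - 1| = 1 - ρ * (1 - Real.log ρ) := by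
  rw [abs_of_nonpos, neg_sub]
  have h := Real.add_one_le_exp (-Real.log ρ)
  rw [Real.exp_neg, Real.exp_log hρ] at h
  have := mul_le_mul_of_nonneg_left h hρ.le
  rw [mul_inv_cancel₀ hρ.ne'] at this
  linarith

/-- Comparison of the noisy and noise-free Metropolis kernels: with `σ = 2M`,
`a = |(1-δ)(1 - log(1-δ)) - 1|` and
`ε⁺ = √(2π) β σ (e^{β²σ²/(2(1-δ)n)}/√((1-δ)n) + e^{β²σ² - a n})`, one has
`-ε⁺ q_β(x,y) ≤ q̃(x,y) - q_β(x,y) ≤ ε⁺ q_β(x,y)` for all `x ≠ y`, all `β ≥ 0`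
and all `n > 0`. -/
theorem qNoisy_sub_qMetropolis_bounds
    {E Ω : Type*} [Fintype E] [MeasurableSpace Ω]
    (q0 : E → E → ℝ) (hq0_nonneg : ∀ x y, 0 ≤ q0 x y)
    (hq0_row : ∀ x, ∑ y, q0 x y = 1)
    (P : E → Measure Ω) [∀ x, IsProbabilityMeasure (P x)]
    (U : E → Ω → ℝ) (hU_meas : ∀ x, Measurable (U x))
    (M : ℝ) (hM : 0 < M) (hU : ∀ x ω, 0 ≤ U x ω ∧ U x ω ≤ M)
    (J : E → ℝ) (hJ : ∀ x, J x = ∫ ω, U x ω ∂(P x))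
    (δ : ℝ) (hδ : δ ∈ Set.Ioo (0:ℝ) 1)
    (β n : ℝ) (hβ : 0 ≤ β) (hn : 0 < n)
    (x y : E) (hxy : x ≠ y) :
    -(Real.sqrt (2 * π) * β * (2 * M) *
        (Real.exp (β ^ 2 * (2 * M) ^ 2 / (2 * (1 - δ) * n)) / Real.sqrt ((1 - δ) * n) +
          Real.exp (β ^ 2 * (2 * M) ^ 2 -
            |(1 - δ) * (1 - Real.log (1 - δ)) - 1| * n))) * qMetropolis q0 J β x y ≤
      qNoisy q0 P U β n x y - qMetropolis q0 J β x y ∧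
    qNoisy q0 P U β n x y - qMetropolis q0 J β x y ≤
      (Real.sqrt (2 * π) * β * (2 * M) *
        (Real.exp (β ^ 2 * (2 * M) ^ 2 / (2 * (1 - δ) * n)) / Real.sqrt ((1 - δ) * n) +
          Real.exp (β ^ 2 * (2 * M) ^ 2 -
            |(1 - δ) * (1 - Real.log (1 - δ)) - 1| * n))) * qMetropolis q0 J β x y := by
  obtain ⟨hδ0, hδ1⟩ := hδ
  have hρ : 0 < 1 - δ := by linarith
  rw [abs_chernoff_exponent hρ]
  set ρ := 1 - δ with hρd
  set b := β * (2 * M) with hb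
  have hb0 : 0 ≤ b := by positivity
  set e := Real.exp (-β * max (J y - J x) 0) with he
  set p : ℕ → ℝ := fun k => Real.exp (-n) * n ^ k / (Nat.factorial k) with hp
  set I : ℕ → ℝ := fun k => ∫ ω : (Fin (k + 1) → Ω) × (Fin (k + 1) → Ω),
      Real.exp (-(β / (k + 1)) * max 0 (∑ i, (U y (ω.2 i) - U x (ω.1 i))))
      ∂((Measure.pi fun _ : Fin (k + 1) => P x).prod (Measure.pi fun _ : Fin (k + 1) => P y))
    with hI
  set A := b * (Real.exp (b ^ 2 / (2 * ρ * n)) / √(ρ * n)) with hA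
  set B := b * Real.exp (b ^ 2 - ρ * n * Real.log ρ) with hB
  have hp0 (k : ℕ) : 0 ≤ p k := by positivity
  have hp1 : HasSum p 1 := by simpa using hasSum_poisson_weight_mul_pow n 1
  have hpρ : HasSum (fun k => p k * ρ ^ k) (Real.exp (n * ρ - n)) :=
    hasSum_poisson_weight_mul_pow n ρ
  have hdiff (k : ℕ) : |I k - e| ≤ e * (A + B * ρ ^ k) := by
    have h := abs_integral_noisy_acceptance_sub_le (P x) (P y) (hU_meas x) (hU_meas y) hM
      (hU x) (hU y) hβ k
    rw [← hJ, ← hJ, ← mul_pow] at h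
    exact h.trans (mul_le_mul_of_nonneg_left
      (div_sqrt_mul_exp_le_chernoff hb0 hn hρ (by linarith) k) (Real.exp_pos _).le)
  have hg : HasSum (fun k => p k * (e * (A + B * ρ ^ k)))
      (e * (A + B * Real.exp (n * ρ - n))) := by
    have h := ((hp1.mul_left A).add (hpρ.mul_left B)).mul_left e
    rw [mul_one] at h
    have heq (k : ℕ) : e * (A * p k + B * (p k * ρ ^ k)) = p k * (e * (A + B * ρ ^ k)) := by ring
    simpa only [heq] using h
  have hbound (k : ℕ) : ‖p k * (I k - e)‖ ≤ p k * (e * (A + B * ρ ^ k)) := by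
    rw [Real.norm_eq_abs, abs_mul, abs_of_nonneg (hp0 k)]
    exact mul_le_mul_of_nonneg_left (hdiff k) (hp0 k)
  have hsd : Summable fun k => p k * (I k - e) := hg.summable.of_norm_bounded hbound
  have hsum : ∑' k, p k * I k - e = ∑' k, p k * (I k - e) := by
    have h := (hsd.hasSum.add (hp1.mul_right e)).tsum_eq
    have h2 : ∀ k, p k * (I k - e) + p k * e = p k * I k := fun k => by ring
    simp only [h2] at h
    rw [h]; ring
  have hmain : |∑' k, p k * I k - e| ≤ e * (A + B * Real.exp (n * ρ - n)) := by
    rw [hsum]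
    exact tsum_of_norm_bounded hg hbound
  have hsqrt : 1 ≤ √(2 * π) := Real.one_le_sqrt.2 (by linarith [Real.pi_gt_three])
  set ε := √(2 * π) * β * (2 * M) * (Real.exp (β ^ 2 * (2 * M) ^ 2 / (2 * ρ * n)) / √(ρ * n) +
    Real.exp (β ^ 2 * (2 * M) ^ 2 - (1 - ρ * (1 - Real.log ρ)) * n)) with hε
  have hABε : A + B * Real.exp (n * ρ - n) ≤ ε := by
    have h1 : B * Real.exp (n * ρ - n) =
        b * Real.exp (b ^ 2 - (1 - ρ * (1 - Real.log ρ)) * n) := by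
      rw [hB, mul_assoc, ← Real.exp_add]; ring_nf
    rw [h1, hA, ← mul_add, hε, ← mul_pow, mul_assoc (√(2 * π)), mul_assoc (√(2 * π))]
    exact le_mul_of_one_le_left (by positivity) hsqrt
  have hfin : |∑' k, p k * I k - e| ≤ e * ε :=
    hmain.trans (mul_le_mul_of_nonneg_left hABε (Real.exp_pos _).le)
  have hq : qNoisy q0 P U β n x y - qMetropolis q0 J β x y = q0 x y * (∑' k, p k * I k - e) := by
    rw [mul_sub]; rfl
  have hqm : qMetropolis q0 J β x y = q0 x y * e := rfl
  have habs : |qNoisy q0 P U β n x y - qMetropolis q0 J β x y| ≤ ε * qMetropolis q0 J β x y := by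
    rw [hq, hqm, abs_mul, abs_of_nonneg (hq0_nonneg x y)]
    calc _ ≤ q0 x y * (e * ε) := mul_le_mul_of_nonneg_left hfin (hq0_nonneg x y)
      _ = _ := by ring
  rw [neg_mul]
  exact abs_le.1 habs
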